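/- Let a be a real number, let n ≥ 1, and set h = (2n)^{−1/3} and x_i = h·i. Let T be the 2n×2n tridiagonal matrix with zero main diagonal, every superdiagonal entry equal to √n, and subdiagonal entries given by (2i, 2i−1) entry = (a+n+1−i)/√n for i=1,…,n and (2i+1, 2i) entry = (n−i)/√n for i=1,…,n−1 (this is the shuffled ∞-Laguerre matrix model). Then −√(2/h)·(T − √2·h^{−3/2}·I_{2n}) = (1/h²)·Δ_{2n} + diag_{−1}(x_1, x_2, …, x_{2n−1}) + E, where E is the 2n×2n matrix whose (j+1, j) entry equals −h(2a+1) for every odd j ∈ {1,3,…,2n−1} and all of whose other entries are zero. In particular, if a = −1/2 then E is the zero matrix. -/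

import Mathlib

open Matrix Real

/-- The mesh size `h = m ^ (-1/3)` satisfies `m * h ^ 3 = 1`. -/
lemma mul_rpow_neg_third_pow_three {m : ℝ} (hm : 0 < m) :
    m * (m ^ (-(1 / 3 : ℝ))) ^ 3 = 1 := by
  rw [← Real.rpow_natCast, ← Real.rpow_mul hm.le]
  norm_num [Real.rpow_neg_one, hm.ne']

lemma sqrt_two_div_mul_sqrt {h m : ℝ} (hpos : 0 < h) (hm : 2 * m * h ^ 3 = 1) :
    √(2 / h) * √m = 1 / h ^ 2 := by
  rw [← Real.sqrt_mul (by positivity), Real.sqrt_eq_iff_mul_self_eq_of_pos (by positivity)]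
  field_simp
  linear_combination -hm

lemma sqrt_two_div_div_sqrt {h m : ℝ} (hpos : 0 < h) (hm0 : 0 < m) (hm : 2 * m * h ^ 3 = 1) :
    √(2 / h) / √m = 2 * h := by
  rw [← Real.sqrt_div (by positivity), Real.sqrt_eq_iff_mul_self_eq_of_pos (by positivity)]
  field_simp
  linear_combination hm

lemma sqrt_two_div_mul_sqrt_two_mul_rpow {h : ℝ} (hpos : 0 < h) :
    √(2 / h) * (√2 * h ^ (-(3 / 2) : ℝ)) = 2 / h ^ 2 := by
  have hsq : (h ^ (-(3 / 2) : ℝ)) ^ 2 = 1 / h ^ 3 := by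
    rw [← Real.rpow_natCast, ← Real.rpow_mul hpos.le, one_div, ← Real.rpow_natCast h 3,
      ← Real.rpow_neg hpos.le]
    norm_num
  rw [← pow_left_inj₀ (by positivity) (by positivity) two_ne_zero, mul_pow, mul_pow, hsq,
    Real.sq_sqrt (by positivity), Real.sq_sqrt (by positivity)]
  field_simp

/-- The shuffled square ∞-Laguerre matrix model, scaled at the soft
edge, equals `(1/h²)Δ₂ₙ + diag₋₁(x₁,…,x_{2n−1}) + E` where `E` has entries
`−h(2a+1)` at positions `(j+1,j)` for odd `j` and zeros elsewhere; in particular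
`E = 0` when `a = −1/2`. Here `h = (2n)^{-1/3}` and `x_i = h·i`. -/
theorem laguerre_square_soft_edge_finite_difference (a : ℝ) (n : ℕ) (hn : 1 ≤ n)
    (h : ℝ) (hh : h = ((2 * n : ℕ) : ℝ) ^ (-(1/3 : ℝ)))
    (x : ℕ → ℝ) (hx : ∀ i, x i = h * i)
    (T : Matrix (Fin (2 * n)) (Fin (2 * n)) ℝ)
    (hT : T = Matrix.of fun (i j : Fin (2 * n)) =>
      if (j : ℕ) = (i : ℕ) + 1 then Real.sqrt n
      else if (i : ℕ) = (j : ℕ) + 1 then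
        (if (j : ℕ) % 2 = 0 then (a + (n : ℝ) - (((j : ℕ) / 2 : ℕ) : ℝ)) / Real.sqrt n
         else ((n : ℝ) - ((((j : ℕ) + 1) / 2 : ℕ) : ℝ)) / Real.sqrt n)
      else 0)
    (Δ : Matrix (Fin (2 * n)) (Fin (2 * n)) ℝ)
    (hΔ : Δ = Matrix.of fun (i j : Fin (2 * n)) =>
      if i = j then 2
      else if (j : ℕ) = (i : ℕ) + 1 ∨ (i : ℕ) = (j : ℕ) + 1 then -1
      else 0)
    (X : Matrix (Fin (2 * n)) (Fin (2 * n)) ℝ)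
    (hX : X = Matrix.of fun (i j : Fin (2 * n)) =>
      if (i : ℕ) = (j : ℕ) + 1 then x ((j : ℕ) + 1) else 0)
    (E : Matrix (Fin (2 * n)) (Fin (2 * n)) ℝ)
    (hE : E = Matrix.of fun (i j : Fin (2 * n)) =>
      if (i : ℕ) = (j : ℕ) + 1 ∧ (j : ℕ) % 2 = 0 then -h * (2 * a + 1) else 0) :
    (-Real.sqrt (2 / h)) •
        (T - (Real.sqrt 2 * h ^ (-(3/2) : ℝ)) • (1 : Matrix (Fin (2 * n)) (Fin (2 * n)) ℝ))
      = (1 / h ^ 2) • Δ + X + E ∧ (a = -(1/2) → E = 0) := by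
  have hn0 : (0 : ℝ) < n := by exact_mod_cast hn
  have hpos : 0 < h := by rw [hh]; positivity
  have hcube : 2 * (n : ℝ) * h ^ 3 = 1 := by
    have := mul_rpow_neg_third_pow_three (m := ((2 * n : ℕ) : ℝ)) (by positivity)
    rw [← hh] at this
    exact_mod_cast this
  have hsup := sqrt_two_div_mul_sqrt hpos hcube
  have hsub := sqrt_two_div_div_sqrt hpos hn0 hcube
  have hdiag := sqrt_two_div_mul_sqrt_two_mul_rpow hpos
  have hinv : 1 / h ^ 2 = 2 * h * n := by
    field_simp
    linear_combination -hcube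
  constructor
  · ext i j
    simp only [hT, hΔ, hX, hE, hx, Matrix.smul_apply, Matrix.sub_apply, Matrix.add_apply,
      Matrix.of_apply, Matrix.one_apply, smul_eq_mul]
    by_cases hij : i = j
    · subst hij
      simp only [Nat.left_eq_add, one_ne_zero, if_true, if_false, false_and]
      linear_combination hdiag
    by_cases hup : (j : ℕ) = i + 1
    · simp only [hij, hup, if_true, if_false, true_or]
      rw [if_neg (by omega), if_neg (by omega)]
      linear_combination -hsup
    by_cases hlow : (i : ℕ) = j + 1
    · simp only [hij, hlow, if_true, if_false, or_true, true_and]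
      rcases Nat.even_or_odd' (j : ℕ) with ⟨k, hk | hk⟩
      · have h1 : (2 * k) / 2 = k := by omega
        have h2 : (2 * k) % 2 = 0 := by omega
        simp only [hk, h1, h2, if_true]
        rw [if_neg (by omega)]
        push_cast
        linear_combination (-(a + n - k)) * hsub + hinv
      · have h1 : (2 * k + 1 + 1) / 2 = k + 1 := by omega
        have h2 : ¬ (2 * k + 1) % 2 = 0 := by omega
        simp only [hk, h1, h2, if_false]
        rw [if_neg (by omega)]
        push_cast
        linear_combination (-(n - (k + 1))) * hsub + hinv
    · simp [hij, hup, hlow]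
  · rintro rfl
    ext i j
    simp [hE]
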